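/- With notation as in the context, let K := β·x₁ and assume K ≠ 0 (as a rational number). Let Nβ, X11 ∈ ℚ, let c1H := −2·Nβ, let c1B(β₁,β₂) := −w(β₁,β₂) for (β₁,β₂) ∈ S, and let c1E := −(X11/K)·Nβ + (1/(2K))·Σ_{(β₁,β₂)∈S} w(β₁,β₂)·(β₁·x₁)·(β₂·x₁). If c1sq := (1/K²)·( X11·c1H − 2K·c1E + Σ_{(β₁,β₂)∈S} c1B(β₁,β₂)·(β₂·x₁)² ), then c1sq = −(1/2)·Σ_{(β₁,β₂)∈S} w(β₁,β₂). -/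

import Mathlib

/-- A sum over a finite set of pairs closed under swapping is invariant under swapping. -/
theorem sum_swap_of_swap_mem {α M : Type*} [AddCommMonoid M] (S : Finset (α × α))
    (hS : ∀ p ∈ S, p.swap ∈ S) (f : α × α → M) :
    ∑ p ∈ S, f p.swap = ∑ p ∈ S, f p :=
  Finset.sum_nbij' Prod.swap Prod.swap hS hS (fun p _ => p.swap_swap) (fun p _ => p.swap_swap)
    (fun _ _ => rfl)

/-- Equation (3.6) of the paper: pairing the divisor relation of Lemma 4.1
with `c₁(ξ*)` computes `c1sq = ⟨c₁(ξ*)², [M̄]⟩ = −(1/2)·Σ w(β₁,β₂)`.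
Here `K = β·x₁`, `c1H = ⟨c₁(ξ*)·H, [M̄]⟩ = −2N_β` (equation (4.7)),
`c1B(β₁,β₂) = ⟨c₁(ξ*)·B_{β₁,β₂}, [M̄]⟩ = −w(β₁,β₂)` (equation (4.8)),
and `c1E = ⟨c₁(ξ*)·ev*(x₁), [M̄]⟩` (equation (3.5)). -/
theorem stmt_5 {Λ : Type*} [AddCommGroup Λ]
    (B : Λ → Λ → ℤ)
    (hBsymm : ∀ a b : Λ, B a b = B b a)
    (hBadd : ∀ a a' b : Λ, B (a + a') b = B a b + B a' b)
    (x₁ β : Λ) (S : Finset (Λ × Λ))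
    (hsplit : ∀ p ∈ S, p.1 + p.2 = β)
    (hswap : ∀ p ∈ S, (p.2, p.1) ∈ S)
    (hδ : ∀ p ∈ S, 0 ≤ B p.1 x₁ - 1)
    (N : Λ → ℚ) (w : Λ × Λ → ℚ)
    (hw : ∀ p : Λ × Λ, w p =
      (Nat.choose (B β x₁ - 2).toNat (B p.1 x₁ - 1).toNat : ℚ)
        * N p.1 * N p.2 * (B p.1 p.2 : ℚ))
    (K : ℚ) (hKdef : K = (B β x₁ : ℚ)) (hK : K ≠ 0)
    (Nβ X11 c1H : ℚ) (c1B : Λ × Λ → ℚ) (c1E : ℚ)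
    (hc1H : c1H = -2 * Nβ)
    (hc1B : ∀ p ∈ S, c1B p = -w p)
    (hc1E : c1E = -(X11 / K) * Nβ
      + (1 / (2 * K)) * ∑ p ∈ S, w p * (B p.1 x₁ : ℚ) * (B p.2 x₁ : ℚ))
    (c1sq : ℚ)
    (hc1sq : c1sq = (1 / K ^ 2) *
      (X11 * c1H - 2 * K * c1E + ∑ p ∈ S, c1B p * (B p.2 x₁ : ℚ) ^ 2)) :
    c1sq = -(1 / 2) * ∑ p ∈ S, w p := by
  have hB : ∀ p ∈ S, B p.1 x₁ + B p.2 x₁ = B β x₁ := fun p hp => by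
    rw [← hBadd, hsplit p hp]
  have hBK : ∀ p ∈ S, (B p.1 x₁ : ℚ) + B p.2 x₁ = K := fun p hp => by
    rw [hKdef]; exact_mod_cast hB p hp
  have hwsymm : ∀ p ∈ S, w p.swap = w p := fun p hp => by
    have h₁ := hδ p hp
    have h₂ := hδ _ (hswap p hp)
    have h := hB p hp
    rw [hw, hw, Prod.fst_swap, Prod.snd_swap, hBsymm p.2 p.1,
      Nat.choose_symm_of_eq_add (a := (B p.2 x₁ - 1).toNat) (b := (B p.1 x₁ - 1).toNat)
        (by dsimp only at h₂; lia)]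
    ring
  have hsum : ∑ p ∈ S, w p * (B p.1 x₁ : ℚ) = ∑ p ∈ S, w p * (B p.2 x₁ : ℚ) := by
    rw [← sum_swap_of_swap_mem S hswap fun p => w p * (B p.2 x₁ : ℚ)]
    exact Finset.sum_congr rfl fun p hp => by rw [hwsymm p hp, Prod.snd_swap]
  have hsum_add : ∑ p ∈ S, w p * (B p.1 x₁ : ℚ) + ∑ p ∈ S, w p * (B p.2 x₁ : ℚ)
      = K * ∑ p ∈ S, w p := by
    rw [← Finset.sum_add_distrib, Finset.mul_sum]
    exact Finset.sum_congr rfl fun p hp => by rw [← hBK p hp]; ring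
  have hboundary : ∑ p ∈ S, c1B p * (B p.2 x₁ : ℚ) ^ 2
      = ∑ p ∈ S, w p * (B p.1 x₁ : ℚ) * (B p.2 x₁ : ℚ)
        - K * ∑ p ∈ S, w p * (B p.2 x₁ : ℚ) := by
    rw [Finset.mul_sum, ← Finset.sum_sub_distrib]
    exact Finset.sum_congr rfl fun p hp => by rw [hc1B p hp, ← hBK p hp]; ring
  have hhalf : ∑ p ∈ S, w p * (B p.2 x₁ : ℚ) = K / 2 * ∑ p ∈ S, w p := by
    linarith
  rw [hc1sq, hboundary, hhalf, hc1E, hc1H]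
  field_simp
  ring
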